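/- For each i ∈ {1,2,3}, the five functions I₁₂, I₂₃, I₁₂₃ (with β₁ = β₂ = β₃ = 0), the Kepler–Coulomb Hamiltonian H^KC, and the Laplace–Runge–Lenz component Lᵢ are functionally independent on D; that is, there exists a point of D at which their five gradients (vectors in ℝ⁶) are linearly independent. Consequently H^KC is a maximally superintegrable Hamiltonian. -/

import Mathlib

namespace Paper
noncomputable section

/-- The κ-dependent cosine Cκ(x) = ∑ (−κ)^l x^{2l}/(2l)!. -/
def Ck (κ x : ℝ) : ℝ := ∑' l : ℕ, (-κ) ^ l * x ^ (2 * l) / (Nat.factorial (2 * l) : ℝ)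

/-- The κ-dependent sine Sκ(x) = ∑ (−κ)^l x^{2l+1}/(2l+1)!. -/
def Sk (κ x : ℝ) : ℝ := ∑' l : ℕ, (-κ) ^ l * x ^ (2 * l + 1) / (Nat.factorial (2 * l + 1) : ℝ)

/-- The κ-dependent tangent Tκ(x) = Sκ(x)/Cκ(x). -/
def Tk (κ x : ℝ) : ℝ := Sk κ x / Ck κ x

/-- Phase space ℝ³ × ℝ³ ≃ ℝ⁶ with canonical coordinates
`(r, θ, φ, p_r, p_θ, p_φ) = (x 0, x 1, x 2, x 3, x 4, x 5)`. -/
abbrev Pt := Fin 6 → ℝ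

/-- Partial derivative in the i-th coordinate direction. -/
def pd (f : Pt → ℝ) (i : Fin 6) (x : Pt) : ℝ := fderiv ℝ f x (Pi.single i 1)

/-- Canonical Poisson bracket {f,g} = ∑_{q} (∂f/∂q ∂g/∂p_q − ∂g/∂q ∂f/∂p_q). -/
def pb (f g : Pt → ℝ) (x : Pt) : ℝ :=
  ∑ i : Fin 3,
    (pd f ⟨i.1, by omega⟩ x * pd g ⟨i.1 + 3, by omega⟩ x
      - pd g ⟨i.1, by omega⟩ x * pd f ⟨i.1 + 3, by omega⟩ x)

/-- Gradient of a function on phase space, as a vector in ℝ⁶. -/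
def grad (f : Pt → ℝ) (x : Pt) : Fin 6 → ℝ := fun i => pd f i x

/-- The open domain D where Sκ₁(r), Cκ₁(r), Sκ₂(θ), Cκ₂(θ), cos φ, sin φ are nonzero. -/
def D (κ₁ κ₂ : ℝ) : Set Pt :=
  {x | Sk κ₁ (x 0) ≠ 0 ∧ Ck κ₁ (x 0) ≠ 0 ∧ Sk κ₂ (x 1) ≠ 0 ∧ Ck κ₂ (x 1) ≠ 0 ∧
       Real.cos (x 2) ≠ 0 ∧ Real.sin (x 2) ≠ 0}

/-- J₀₁ = Cκ₂(θ)p_r − (Sκ₂(θ)/Tκ₁(r))p_θ. -/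
def J01 (κ₁ κ₂ : ℝ) (x : Pt) : ℝ :=
  Ck κ₂ (x 1) * x 3 - (Sk κ₂ (x 1) / Tk κ₁ (x 0)) * x 4

/-- J₀₂. -/
def J02 (κ₁ κ₂ : ℝ) (x : Pt) : ℝ :=
  κ₂ * Sk κ₂ (x 1) * Real.cos (x 2) * x 3
    + (Ck κ₂ (x 1) * Real.cos (x 2) / Tk κ₁ (x 0)) * x 4
    - (Real.sin (x 2) / (Tk κ₁ (x 0) * Sk κ₂ (x 1))) * x 5

/-- J₀₃. -/
def J03 (κ₁ κ₂ : ℝ) (x : Pt) : ℝ :=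
  κ₂ * Sk κ₂ (x 1) * Real.sin (x 2) * x 3
    + (Ck κ₂ (x 1) * Real.sin (x 2) / Tk κ₁ (x 0)) * x 4
    + (Real.cos (x 2) / (Tk κ₁ (x 0) * Sk κ₂ (x 1))) * x 5

/-- J₁₂ = cos φ·p_θ − (sin φ/Tκ₂(θ))p_φ. -/
def J12 (κ₂ : ℝ) (x : Pt) : ℝ :=
  Real.cos (x 2) * x 4 - (Real.sin (x 2) / Tk κ₂ (x 1)) * x 5

/-- J₁₃ = sin φ·p_θ + (cos φ/Tκ₂(θ))p_φ. -/
def J13 (κ₂ : ℝ) (x : Pt) : ℝ :=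
  Real.sin (x 2) * x 4 + (Real.cos (x 2) / Tk κ₂ (x 1)) * x 5

/-- J₂₃ = p_φ. -/
def J23 (x : Pt) : ℝ := x 5

/-- Kinetic energy T. -/
def Tkin (κ₁ κ₂ : ℝ) (x : Pt) : ℝ :=
  (1 / 2) * ((x 3) ^ 2 + (x 4) ^ 2 / (κ₂ * Sk κ₁ (x 0) ^ 2)
    + (x 5) ^ 2 / (κ₂ * Sk κ₁ (x 0) ^ 2 * Sk κ₂ (x 1) ^ 2))

/-- The superintegrable potential U with arbitrary radial function F. -/
def U (κ₁ κ₂ : ℝ) (F : ℝ → ℝ) (β₁ β₂ β₃ : ℝ) (x : Pt) : ℝ :=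
  F (x 0) + (1 / Sk κ₁ (x 0) ^ 2) *
    (β₁ / Ck κ₂ (x 1) ^ 2 + β₂ / (Sk κ₂ (x 1) ^ 2 * Real.cos (x 2) ^ 2)
      + β₃ / (Sk κ₂ (x 1) ^ 2 * Real.sin (x 2) ^ 2))

/-- Integral I₁₂. -/
def I12 (κ₂ β₁ β₂ : ℝ) (x : Pt) : ℝ :=
  (Real.cos (x 2) * x 4 - (Real.sin (x 2) / Tk κ₂ (x 1)) * x 5) ^ 2
    + 2 * β₁ * κ₂ ^ 2 * Tk κ₂ (x 1) ^ 2 * Real.cos (x 2) ^ 2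
    + 2 * β₂ * κ₂ / (Tk κ₂ (x 1) ^ 2 * Real.cos (x 2) ^ 2)

/-- Integral I₁₃. -/
def I13 (κ₂ β₁ β₃ : ℝ) (x : Pt) : ℝ :=
  (Real.sin (x 2) * x 4 + (Real.cos (x 2) / Tk κ₂ (x 1)) * x 5) ^ 2
    + 2 * β₁ * κ₂ ^ 2 * Tk κ₂ (x 1) ^ 2 * Real.sin (x 2) ^ 2
    + 2 * β₃ * κ₂ / (Tk κ₂ (x 1) ^ 2 * Real.sin (x 2) ^ 2)

/-- Integral I₂₃. -/
def I23 (κ₂ β₂ β₃ : ℝ) (x : Pt) : ℝ :=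
  (x 5) ^ 2 + 2 * β₂ * κ₂ * Real.tan (x 2) ^ 2 + 2 * β₃ * κ₂ / Real.tan (x 2) ^ 2

/-- Integral I₁₂₃. -/
def I123 (κ₂ β₁ β₂ β₃ : ℝ) (x : Pt) : ℝ :=
  (x 4) ^ 2 + (x 5) ^ 2 / Sk κ₂ (x 1) ^ 2 + 2 * β₁ * κ₂ / Ck κ₂ (x 1) ^ 2
    + 2 * β₂ * κ₂ / (Sk κ₂ (x 1) ^ 2 * Real.cos (x 2) ^ 2)
    + 2 * β₃ * κ₂ / (Sk κ₂ (x 1) ^ 2 * Real.sin (x 2) ^ 2)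

/-- The Smorodinsky–Winternitz Hamiltonian H^SW. -/
def HSW (κ₁ κ₂ β₀ β₁ β₂ β₃ : ℝ) (x : Pt) : ℝ :=
  Tkin κ₁ κ₂ x + β₀ * Tk κ₁ (x 0) ^ 2 + (1 / Sk κ₁ (x 0) ^ 2) *
    (β₁ / Ck κ₂ (x 1) ^ 2 + β₂ / (Sk κ₂ (x 1) ^ 2 * Real.cos (x 2) ^ 2)
      + β₃ / (Sk κ₂ (x 1) ^ 2 * Real.sin (x 2) ^ 2))

/-- Integral I₀₁ of H^SW. -/
def I01 (κ₁ κ₂ β₀ β₁ : ℝ) (x : Pt) : ℝ :=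
  J01 κ₁ κ₂ x ^ 2 + 2 * β₀ * Tk κ₁ (x 0) ^ 2 * Ck κ₂ (x 1) ^ 2
    + 2 * β₁ / (Tk κ₁ (x 0) ^ 2 * Ck κ₂ (x 1) ^ 2)

/-- Integral I₀₂ of H^SW. -/
def I02 (κ₁ κ₂ β₀ β₂ : ℝ) (x : Pt) : ℝ :=
  J02 κ₁ κ₂ x ^ 2 + 2 * β₀ * κ₂ ^ 2 * Tk κ₁ (x 0) ^ 2 * Sk κ₂ (x 1) ^ 2 * Real.cos (x 2) ^ 2
    + 2 * β₂ * κ₂ / (Tk κ₁ (x 0) ^ 2 * Sk κ₂ (x 1) ^ 2 * Real.cos (x 2) ^ 2)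

/-- Integral I₀₃ of H^SW. -/
def I03 (κ₁ κ₂ β₀ β₃ : ℝ) (x : Pt) : ℝ :=
  J03 κ₁ κ₂ x ^ 2 + 2 * β₀ * κ₂ ^ 2 * Tk κ₁ (x 0) ^ 2 * Sk κ₂ (x 1) ^ 2 * Real.sin (x 2) ^ 2
    + 2 * β₃ * κ₂ / (Tk κ₁ (x 0) ^ 2 * Sk κ₂ (x 1) ^ 2 * Real.sin (x 2) ^ 2)

/-- Generalized Kepler–Coulomb Hamiltonian H^GKC₁ = T + U^GKC₁. -/
def HGKC1 (κ₁ κ₂ k β₂ β₃ : ℝ) (x : Pt) : ℝ :=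
  Tkin κ₁ κ₂ x - k / Tk κ₁ (x 0)
    + (1 / (Sk κ₁ (x 0) ^ 2 * Sk κ₂ (x 1) ^ 2)) *
        (β₂ / Real.cos (x 2) ^ 2 + β₃ / Real.sin (x 2) ^ 2)

/-- Generalized Kepler–Coulomb Hamiltonian H^GKC₂ = T + U^GKC₂. -/
def HGKC2 (κ₁ κ₂ k β₁ β₃ : ℝ) (x : Pt) : ℝ :=
  Tkin κ₁ κ₂ x - k / Tk κ₁ (x 0)
    + (1 / Sk κ₁ (x 0) ^ 2) *
        (β₁ / Ck κ₂ (x 1) ^ 2 + β₃ / (Sk κ₂ (x 1) ^ 2 * Real.sin (x 2) ^ 2))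

/-- Generalized Kepler–Coulomb Hamiltonian H^GKC₃ = T + U^GKC₃. -/
def HGKC3 (κ₁ κ₂ k β₁ β₂ : ℝ) (x : Pt) : ℝ :=
  Tkin κ₁ κ₂ x - k / Tk κ₁ (x 0)
    + (1 / Sk κ₁ (x 0) ^ 2) *
        (β₁ / Ck κ₂ (x 1) ^ 2 + β₂ / (Sk κ₂ (x 1) ^ 2 * Real.cos (x 2) ^ 2))

/-- The function L₁. -/
def L1 (κ₁ κ₂ k β₂ β₃ : ℝ) (x : Pt) : ℝ :=
  -(J02 κ₁ κ₂ x * J12 κ₂ x) - J03 κ₁ κ₂ x * J13 κ₂ x + k * κ₂ * Ck κ₂ (x 1)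
    - (2 * κ₂ * Ck κ₂ (x 1) / (Tk κ₁ (x 0) * Sk κ₂ (x 1) ^ 2)) *
        (β₂ / Real.cos (x 2) ^ 2 + β₃ / Real.sin (x 2) ^ 2)

/-- The function L₂. -/
def L2 (κ₁ κ₂ k β₁ β₃ : ℝ) (x : Pt) : ℝ :=
  J01 κ₁ κ₂ x * J12 κ₂ x - J03 κ₁ κ₂ x * J23 x + k * κ₂ * Sk κ₂ (x 1) * Real.cos (x 2)
    - (2 * κ₂ * Real.cos (x 2) / Tk κ₁ (x 0)) *
        (β₁ * Sk κ₂ (x 1) / Ck κ₂ (x 1) ^ 2 + β₃ / (Sk κ₂ (x 1) * Real.sin (x 2) ^ 2))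

/-- The function L₃. -/
def L3 (κ₁ κ₂ k β₁ β₂ : ℝ) (x : Pt) : ℝ :=
  J01 κ₁ κ₂ x * J13 κ₂ x + J02 κ₁ κ₂ x * J23 x + k * κ₂ * Sk κ₂ (x 1) * Real.sin (x 2)
    - (2 * κ₂ * Real.sin (x 2) / Tk κ₁ (x 0)) *
        (β₁ * Sk κ₂ (x 1) / Ck κ₂ (x 1) ^ 2 + β₂ / (Sk κ₂ (x 1) * Real.cos (x 2) ^ 2))

lemma Ck_sq (w x : ℝ) : Ck (w ^ 2) x = Real.cos (w * x) := by
  rw [← (Real.hasSum_cos (w * x)).tsum_eq]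
  refine tsum_congr fun l => ?_
  rw [neg_pow, ← pow_mul, mul_pow, mul_assoc]

lemma Ck_neg_sq (w x : ℝ) : Ck (-w ^ 2) x = Real.cosh (w * x) := by
  rw [← (Real.hasSum_cosh (w * x)).tsum_eq]
  refine tsum_congr fun l => ?_
  rw [neg_neg, ← pow_mul, mul_pow]

lemma mul_Sk_sq (w x : ℝ) : w * Sk (w ^ 2) x = Real.sin (w * x) := by
  rw [← (Real.hasSum_sin (w * x)).tsum_eq, Sk, ← tsum_mul_left]
  refine tsum_congr fun l => ?_
  rw [neg_pow, ← pow_mul, mul_pow]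
  ring

lemma mul_Sk_neg_sq (w x : ℝ) : w * Sk (-w ^ 2) x = Real.sinh (w * x) := by
  rw [← (Real.hasSum_sinh (w * x)).tsum_eq, Sk, ← tsum_mul_left]
  refine tsum_congr fun l => ?_
  rw [neg_neg, ← pow_mul, mul_pow]
  ring

lemma Ck_zero_left (x : ℝ) : Ck 0 x = 1 := by
  rw [Ck, tsum_eq_single 0 (by intro l hl; simp [hl])]
  simp

lemma Sk_zero_left (x : ℝ) : Sk 0 x = x := by
  rw [Sk, tsum_eq_single 0 (by intro l hl; simp [hl])]
  simp

lemma eq_zero_or_sq_or_neg_sq (κ : ℝ) : κ = 0 ∨ ∃ w : ℝ, w ≠ 0 ∧ (κ = w ^ 2 ∨ κ = -w ^ 2) := by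
  rcases eq_or_ne κ 0 with h | h
  · exact Or.inl h
  · refine Or.inr ⟨√|κ|, (Real.sqrt_pos.2 (abs_pos.2 h)).ne', ?_⟩
    rw [Real.sq_sqrt (abs_nonneg κ)]
    exact eq_or_eq_neg_of_abs_eq rfl

lemma Sk_sq {w : ℝ} (hw : w ≠ 0) : Sk (w ^ 2) = fun x => Real.sin (w * x) / w :=
  funext fun x => (eq_div_iff hw).2 (by rw [mul_comm, mul_Sk_sq])

lemma Sk_neg_sq {w : ℝ} (hw : w ≠ 0) : Sk (-w ^ 2) = fun x => Real.sinh (w * x) / w :=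
  funext fun x => (eq_div_iff hw).2 (by rw [mul_comm, mul_Sk_neg_sq])

lemma hasDerivAt_Sk (κ x : ℝ) : HasDerivAt (Sk κ) (Ck κ x) x := by
  rcases eq_zero_or_sq_or_neg_sq κ with rfl | ⟨w, hw, rfl | rfl⟩
  · rw [Ck_zero_left, funext Sk_zero_left]
    exact hasDerivAt_id' x
  · rw [Ck_sq, Sk_sq hw]
    refine ((((hasDerivAt_id' x).const_mul w).sin).div_const w).congr_deriv ?_
    field_simp
  · rw [Ck_neg_sq, Sk_neg_sq hw]
    refine ((((hasDerivAt_id' x).const_mul w).sinh).div_const w).congr_deriv ?_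
    field_simp

@[fun_prop]
lemma differentiable_Sk (κ : ℝ) : Differentiable ℝ (Sk κ) :=
  fun x => (hasDerivAt_Sk κ x).differentiableAt

@[fun_prop]
lemma differentiable_Ck (κ : ℝ) : Differentiable ℝ (Ck κ) := by
  rcases eq_zero_or_sq_or_neg_sq κ with rfl | ⟨w, -, rfl | rfl⟩
  · rw [funext Ck_zero_left]; fun_prop
  · rw [funext (Ck_sq w)]; fun_prop
  · rw [funext (Ck_neg_sq w)]; fun_prop

@[simp]
lemma Ck_zero_right (κ : ℝ) : Ck κ 0 = 1 := by
  rw [Ck, tsum_eq_single 0 (by intro l hl; simp [hl])]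
  simp

@[simp]
lemma Sk_zero_right (κ : ℝ) : Sk κ 0 = 0 := by
  simp [Sk]

lemma exists_Sk_ne_zero_and_Ck_ne_zero (κ : ℝ) : ∃ x, Sk κ x ≠ 0 ∧ Ck κ x ≠ 0 := by
  have hS := (hasDerivAt_Sk κ 0).eventually_ne (c := 0) (by simp)
  have hC := ((differentiable_Ck κ).continuous.continuousAt (x := 0)).eventually_ne
    (y := 0) (by simp)
  exact (hS.and (hC.filter_mono nhdsWithin_le_nhds)).exists

lemma grad_apply_eq {f : Pt → ℝ} {x : Pt} {i : Fin 6} {d : ℝ} (hf : DifferentiableAt ℝ f x)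
    (h : HasDerivAt (fun t => f (Function.update x i t)) d (x i)) : grad f x i = d := by
  have hu := hasDerivAt_update x i (x i)
  rw [← Function.update_eq_self i x] at hf
  have := hf.hasFDerivAt.comp_hasDerivAt (x i) hu
  rw [Function.update_eq_self] at this
  exact this.unique h

lemma hasDerivAt_quadratic {f : ℝ → ℝ} {a b c : ℝ} (h : ∀ t, f t = a * t ^ 2 + b * t + c) (x : ℝ) :
    HasDerivAt f (2 * a * x + b) x := by
  rw [funext h]
  refine ((((hasDerivAt_pow 2 x).const_mul a).add
    ((hasDerivAt_id' x).const_mul b)).add_const c).congr_deriv ?_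
  norm_num
  ring

lemma hasDerivAt_cos_sin {f : ℝ → ℝ} {a b c : ℝ}
    (h : ∀ t, f t = a * Real.cos t + b * Real.sin t + c) (x : ℝ) :
    HasDerivAt f (b * Real.cos x - a * Real.sin x) x := by
  rw [funext h]
  refine ((((Real.hasDerivAt_cos x).const_mul a).add
    ((Real.hasDerivAt_sin x).const_mul b)).add_const c).congr_deriv ?_
  ring

lemma linearIndependent_of_minors {v₁ v₂ v₃ v₄ v₅ : Fin 6 → ℝ}
    (h₂ : v₂ 1 = 0 ∧ v₂ 2 = 0 ∧ v₂ 3 = 0 ∧ v₂ 4 = 0 ∧ v₂ 5 ≠ 0)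
    (h₃ : v₃ 1 ≠ 0 ∧ v₃ 2 = 0 ∧ v₃ 3 = 0 ∧ v₃ 4 = 0)
    (h₄ : v₄ 2 = 0 ∧ v₄ 3 ≠ 0 ∧ v₄ 4 = 0)
    (h : v₁ 2 * v₅ 4 - v₁ 4 * v₅ 2 ≠ 0) :
    LinearIndependent ℝ ![v₁, v₂, v₃, v₄, v₅] := by
  rw [Fintype.linearIndependent_iff]
  intro g hg
  have e (i : Fin 6) :
      g 0 * v₁ i + g 1 * v₂ i + g 2 * v₃ i + g 3 * v₄ i + g 4 * v₅ i = 0 := by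
    simpa [Fin.sum_univ_five] using congrFun hg i
  obtain ⟨a1, a2, a3, a4, a5⟩ := h₂
  obtain ⟨b1, b2, b3, b4⟩ := h₃
  obtain ⟨c2, c3, c4⟩ := h₄
  have e1 := e 1
  have e2 := e 2
  have e3 := e 3
  have e4 := e 4
  have e5 := e 5
  simp only [a1, a2, a3, a4, b2, b3, b4, c2, c4, mul_zero, add_zero] at e1 e2 e3 e4
  have g0 : g 0 = 0 := by
    refine (mul_eq_zero.1 ?_).resolve_right h
    linear_combination v₅ 4 * e2 - v₅ 2 * e4
  have g4 : g 4 = 0 := by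
    refine (mul_eq_zero.1 ?_).resolve_right h
    linear_combination v₁ 2 * e4 - v₁ 4 * e2
  have g3 : g 3 = 0 := by simpa [g0, g4, c3] using e3
  have g2 : g 2 = 0 := by simpa [g0, g3, g4, b1] using e1
  have g1 : g 1 = 0 := by simpa [g0, g2, g3, g4, a5] using e5
  intro i
  fin_cases i <;> assumption

section Differentiability

variable {κ₁ κ₂ : ℝ} {x : Pt}

lemma differentiableAt_Tk {κ y : ℝ} (h : Ck κ y ≠ 0) : DifferentiableAt ℝ (Tk κ) y :=
  ((differentiable_Sk κ) y).div ((differentiable_Ck κ) y) h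

lemma Tk_ne_zero {κ y : ℝ} (hS : Sk κ y ≠ 0) (hC : Ck κ y ≠ 0) : Tk κ y ≠ 0 :=
  div_ne_zero hS hC

lemma differentiableAt_Tk_apply {κ : ℝ} {i : Fin 6} (h : Ck κ (x i) ≠ 0) :
    DifferentiableAt ℝ (fun y : Pt => Tk κ (y i)) x :=
  (differentiableAt_Tk h).fun_comp' x (differentiableAt_apply i x)

lemma differentiableAt_J01 (hx : x ∈ D κ₁ κ₂) : DifferentiableAt ℝ (J01 κ₁ κ₂) x := by
  obtain ⟨h1, h2, h3, h4, -⟩ := hx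
  have hT := differentiableAt_Tk_apply h2
  have := Tk_ne_zero h1 h2
  unfold J01
  fun_prop (disch := assumption)

lemma differentiableAt_J02 (hx : x ∈ D κ₁ κ₂) : DifferentiableAt ℝ (J02 κ₁ κ₂) x := by
  obtain ⟨h1, h2, h3, h4, -⟩ := hx
  have hT := differentiableAt_Tk_apply h2
  have := Tk_ne_zero h1 h2
  have := mul_ne_zero this h3
  unfold J02
  fun_prop (disch := assumption)

lemma differentiableAt_J03 (hx : x ∈ D κ₁ κ₂) : DifferentiableAt ℝ (J03 κ₁ κ₂) x := by
  obtain ⟨h1, h2, h3, h4, -⟩ := hx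
  have hT := differentiableAt_Tk_apply h2
  have := Tk_ne_zero h1 h2
  have := mul_ne_zero this h3
  unfold J03
  fun_prop (disch := assumption)

lemma differentiableAt_J12 (hx : x ∈ D κ₁ κ₂) : DifferentiableAt ℝ (J12 κ₂) x := by
  obtain ⟨h1, h2, h3, h4, -⟩ := hx
  have hT := differentiableAt_Tk_apply h4
  have := Tk_ne_zero h3 h4
  unfold J12
  fun_prop (disch := assumption)

lemma differentiableAt_J13 (hx : x ∈ D κ₁ κ₂) : DifferentiableAt ℝ (J13 κ₂) x := by
  obtain ⟨h1, h2, h3, h4, -⟩ := hx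
  have hT := differentiableAt_Tk_apply h4
  have := Tk_ne_zero h3 h4
  unfold J13
  fun_prop (disch := assumption)

lemma I12_zero_zero (κ : ℝ) : I12 κ 0 0 = fun y => J12 κ y ^ 2 := by
  funext y; simp [I12, J12]

lemma I23_zero_zero (κ : ℝ) : I23 κ 0 0 = fun y => y 5 ^ 2 := by
  funext y; simp [I23]

lemma I123_zero_zero_zero (κ : ℝ) :
    I123 κ 0 0 0 = fun y => y 4 ^ 2 + y 5 ^ 2 / Sk κ (y 1) ^ 2 := by
  funext y; simp [I123]

lemma differentiableAt_I12 (hx : x ∈ D κ₁ κ₂) : DifferentiableAt ℝ (I12 κ₂ 0 0) x := by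
  have := differentiableAt_J12 hx
  rw [I12_zero_zero]
  fun_prop

lemma differentiableAt_I23 : DifferentiableAt ℝ (I23 κ₂ 0 0) x := by
  rw [I23_zero_zero]
  fun_prop

lemma differentiableAt_I123 (hx : x ∈ D κ₁ κ₂) : DifferentiableAt ℝ (I123 κ₂ 0 0 0) x := by
  have := pow_ne_zero 2 hx.2.2.1
  rw [I123_zero_zero_zero]
  fun_prop (disch := assumption)

lemma differentiableAt_HKC (k : ℝ) (hκ₂ : κ₂ ≠ 0) (hx : x ∈ D κ₁ κ₂) :
    DifferentiableAt ℝ (fun y => Tkin κ₁ κ₂ y - k / Tk κ₁ (y 0)) x := by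
  obtain ⟨h1, h2, h3, h4, -⟩ := hx
  have hT := differentiableAt_Tk_apply h2
  have := Tk_ne_zero h1 h2
  have h5 := mul_ne_zero hκ₂ (pow_ne_zero 2 h1)
  have := mul_ne_zero h5 (pow_ne_zero 2 h3)
  unfold Tkin
  fun_prop (disch := assumption)

lemma differentiableAt_LRL₁ (k : ℝ) (hx : x ∈ D κ₁ κ₂) :
    DifferentiableAt ℝ (fun y => -(J02 κ₁ κ₂ y * J12 κ₂ y) - J03 κ₁ κ₂ y * J13 κ₂ y
      + k * κ₂ * Ck κ₂ (y 1)) x := by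
  have := differentiableAt_J02 hx
  have := differentiableAt_J03 hx
  have := differentiableAt_J12 hx
  have := differentiableAt_J13 hx
  fun_prop

lemma differentiableAt_LRL₂ (k : ℝ) (hx : x ∈ D κ₁ κ₂) :
    DifferentiableAt ℝ (fun y => J01 κ₁ κ₂ y * J12 κ₂ y - J03 κ₁ κ₂ y * J23 y
      + k * κ₂ * Sk κ₂ (y 1) * Real.cos (y 2)) x := by
  have := differentiableAt_J01 hx
  have := differentiableAt_J03 hx
  have := differentiableAt_J12 hx
  unfold J23
  fun_prop

lemma differentiableAt_LRL₃ (k : ℝ) (hx : x ∈ D κ₁ κ₂) :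
    DifferentiableAt ℝ (fun y => J01 κ₁ κ₂ y * J13 κ₂ y + J02 κ₁ κ₂ y * J23 y
      + k * κ₂ * Sk κ₂ (y 1) * Real.sin (y 2)) x := by
  have := differentiableAt_J01 hx
  have := differentiableAt_J02 hx
  have := differentiableAt_J13 hx
  unfold J23
  fun_prop

end Differentiability

/-- The phase space point at radius `r`, angles `θ` and `π / 4`, with momenta `(p, 0, 1)`. -/
def testPoint (r θ p : ℝ) : Pt := ![r, θ, Real.pi / 4, p, 0, 1]

section Gradients

variable {κ₁ κ₂ r θ p : ℝ}

lemma testPoint_mem_D (hr : Sk κ₁ r ≠ 0 ∧ Ck κ₁ r ≠ 0) (hθ : Sk κ₂ θ ≠ 0 ∧ Ck κ₂ θ ≠ 0) :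
    testPoint r θ p ∈ D κ₁ κ₂ :=
  ⟨hr.1, hr.2, hθ.1, hθ.2, by simp [testPoint], by simp [testPoint]⟩

lemma grad_I12_testPoint (hx : testPoint r θ p ∈ D κ₁ κ₂) :
    grad (I12 κ₂ 0 0) (testPoint r θ p) 2 = 1 / Tk κ₂ θ ^ 2 ∧
      grad (I12 κ₂ 0 0) (testPoint r θ p) 4 = -1 / Tk κ₂ θ := by
  constructor <;> refine grad_apply_eq (differentiableAt_I12 hx) ?_
  · have h := ((Real.hasDerivAt_sin (Real.pi / 4)).fun_pow 2).div_const (Tk κ₂ θ ^ 2)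
    refine HasDerivAt.congr_deriv (f' := _) (by simpa [I12, testPoint, div_pow] using h) ?_
    simp
    linear_combination (1 / 2 / Tk κ₂ θ ^ 2) * Real.sq_sqrt (zero_le_two (α := ℝ))
  · convert hasDerivAt_quadratic (a := 1 / 2) (b := -1 / Tk κ₂ θ)
      (c := 1 / 2 / Tk κ₂ θ ^ 2) (fun t => ?_) _ using 1
    · simp [testPoint]
    · simp [I12, testPoint]
      linear_combination (1 / 4 * (t - 1 / Tk κ₂ θ) ^ 2) * Real.sq_sqrt (zero_le_two (α := ℝ))

lemma grad_I23_testPoint :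
    grad (I23 κ₂ 0 0) (testPoint r θ p) 1 = 0 ∧ grad (I23 κ₂ 0 0) (testPoint r θ p) 2 = 0 ∧
      grad (I23 κ₂ 0 0) (testPoint r θ p) 3 = 0 ∧ grad (I23 κ₂ 0 0) (testPoint r θ p) 4 = 0 ∧
      grad (I23 κ₂ 0 0) (testPoint r θ p) 5 ≠ 0 := by
  refine ⟨?_, ?_, ?_, ?_, ?_⟩
  iterate 4
    refine grad_apply_eq differentiableAt_I23 ?_
    simpa [I23, testPoint] using hasDerivAt_const _ _
  rw [grad_apply_eq differentiableAt_I23 (d := 2)]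
  · norm_num
  · simpa [I23, testPoint] using hasDerivAt_pow 2 (1 : ℝ)

lemma grad_I123_testPoint (hx : testPoint r θ p ∈ D κ₁ κ₂) :
    grad (I123 κ₂ 0 0 0) (testPoint r θ p) 1 ≠ 0 ∧
      grad (I123 κ₂ 0 0 0) (testPoint r θ p) 2 = 0 ∧
      grad (I123 κ₂ 0 0 0) (testPoint r θ p) 3 = 0 ∧
      grad (I123 κ₂ 0 0 0) (testPoint r θ p) 4 = 0 := by
  have hS : Sk κ₂ θ ≠ 0 := hx.2.2.1
  have hC : Ck κ₂ θ ≠ 0 := hx.2.2.2.1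
  refine ⟨?_, ?_, ?_, ?_⟩
  · rw [grad_apply_eq (differentiableAt_I123 hx)
      (d := -(2 * Sk κ₂ θ * Ck κ₂ θ) / (Sk κ₂ θ ^ 2) ^ 2)]
    · exact div_ne_zero (neg_ne_zero.2 (by positivity)) (by positivity)
    · simpa [I123, testPoint] using ((hasDerivAt_Sk κ₂ θ).fun_pow 2).fun_inv (pow_ne_zero 2 hS)
  iterate 2
    refine grad_apply_eq (differentiableAt_I123 hx) ?_
    simpa [I123, testPoint] using hasDerivAt_const _ _
  · refine grad_apply_eq (differentiableAt_I123 hx) ?_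
    simpa [I123, testPoint] using (hasDerivAt_pow 2 (0 : ℝ))

lemma grad_HKC_testPoint (k : ℝ) (hκ₂ : κ₂ ≠ 0) (hx : testPoint r θ p ∈ D κ₁ κ₂) :
    grad (fun y => Tkin κ₁ κ₂ y - k / Tk κ₁ (y 0)) (testPoint r θ p) 2 = 0 ∧
      grad (fun y => Tkin κ₁ κ₂ y - k / Tk κ₁ (y 0)) (testPoint r θ p) 3 = p ∧
      grad (fun y => Tkin κ₁ κ₂ y - k / Tk κ₁ (y 0)) (testPoint r θ p) 4 = 0 := by
  refine ⟨?_, ?_, ?_⟩ <;> refine grad_apply_eq (differentiableAt_HKC k hκ₂ hx) ?_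
  · simpa [Tkin, testPoint] using hasDerivAt_const _ _
  · convert hasDerivAt_quadratic (a := 1 / 2) (b := 0)
      (c := 1 / 2 / (κ₂ * Sk κ₁ r ^ 2 * Sk κ₂ θ ^ 2) - k / Tk κ₁ r) (fun t => ?_) _ using 1
    · simp [testPoint]
    · simp [Tkin, testPoint]
      ring
  · convert hasDerivAt_quadratic (a := 1 / 2 / (κ₂ * Sk κ₁ r ^ 2)) (b := 0)
      (c := 1 / 2 * p ^ 2 + 1 / 2 / (κ₂ * Sk κ₁ r ^ 2 * Sk κ₂ θ ^ 2) - k / Tk κ₁ r)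
      (fun t => ?_) _ using 1
    · simp [testPoint]
    · simp [Tkin, testPoint]
      ring

lemma grad_LRL₁_testPoint (k : ℝ) (hx : testPoint r θ p ∈ D κ₁ κ₂) :
    grad (fun y => -(J02 κ₁ κ₂ y * J12 κ₂ y) - J03 κ₁ κ₂ y * J13 κ₂ y
        + k * κ₂ * Ck κ₂ (y 1)) (testPoint r θ p) 2 = 0 ∧
      grad (fun y => -(J02 κ₁ κ₂ y * J12 κ₂ y) - J03 κ₁ κ₂ y * J13 κ₂ y
        + k * κ₂ * Ck κ₂ (y 1)) (testPoint r θ p) 4 = -(κ₂ * Sk κ₂ θ * p) := by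
  constructor <;> refine grad_apply_eq (differentiableAt_LRL₁ k hx) ?_
  · convert hasDerivAt_cos_sin (a := 0) (b := 0)
      (c := -(1 / (Tk κ₁ r * Sk κ₂ θ) / Tk κ₂ θ) + k * κ₂ * Ck κ₂ θ) (fun t => ?_) _ using 1
    · simp
    · simp [J02, J03, J12, J13, testPoint]
      linear_combination (-(1 / (Tk κ₁ r * Sk κ₂ θ) / Tk κ₂ θ)) * Real.sin_sq_add_cos_sq t
  · convert hasDerivAt_quadratic (a := -(Ck κ₂ θ / Tk κ₁ r)) (b := -(κ₂ * Sk κ₂ θ * p))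
      (c := -(1 / (Tk κ₁ r * Sk κ₂ θ) / Tk κ₂ θ) + k * κ₂ * Ck κ₂ θ) (fun t => ?_) _ using 1
    · simp [testPoint]
    · simp [J02, J03, J12, J13, testPoint]
      linear_combination (-(1 / 2) * (κ₂ * Sk κ₂ θ * p * t + Ck κ₂ θ / Tk κ₁ r * t ^ 2 +
        1 / (Tk κ₁ r * Sk κ₂ θ) / Tk κ₂ θ)) * Real.sq_sqrt (zero_le_two (α := ℝ))

lemma grad_LRL₂_testPoint (k : ℝ) (hx : testPoint r θ p ∈ D κ₁ κ₂) :
    grad (fun y => J01 κ₁ κ₂ y * J12 κ₂ y - J03 κ₁ κ₂ y * J23 y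
        + k * κ₂ * Sk κ₂ (y 1) * Real.cos (y 2)) (testPoint r θ p) 2 =
      √2 / 2 * (-(Ck κ₂ θ * p / Tk κ₂ θ) - κ₂ * Sk κ₂ θ * p +
        (1 / (Tk κ₁ r * Sk κ₂ θ) - k * κ₂ * Sk κ₂ θ)) ∧
      grad (fun y => J01 κ₁ κ₂ y * J12 κ₂ y - J03 κ₁ κ₂ y * J23 y
        + k * κ₂ * Sk κ₂ (y 1) * Real.cos (y 2)) (testPoint r θ p) 4 =
      √2 / 2 * (Ck κ₂ θ * p) := by
  have hS : Sk κ₂ θ ≠ 0 := hx.2.2.1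
  have hC : Ck κ₂ θ ≠ 0 := hx.2.2.2.1
  constructor <;> refine grad_apply_eq (differentiableAt_LRL₂ k hx) ?_
  · convert hasDerivAt_cos_sin (a := -(1 / (Tk κ₁ r * Sk κ₂ θ)) + k * κ₂ * Sk κ₂ θ)
      (b := -(Ck κ₂ θ * p / Tk κ₂ θ) - κ₂ * Sk κ₂ θ * p) (c := 0) (fun t => ?_) _ using 1
    · simp [testPoint]
      ring
    · simp [J01, J03, J12, J23, testPoint]
      ring
  · convert hasDerivAt_quadratic (a := -(√2 / 2 * (Sk κ₂ θ / Tk κ₁ r)))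
      (b := √2 / 2 * (Ck κ₂ θ * p))
      (c := √2 / 2 * (-(Ck κ₂ θ * p / Tk κ₂ θ) - κ₂ * Sk κ₂ θ * p -
        1 / (Tk κ₁ r * Sk κ₂ θ) + k * κ₂ * Sk κ₂ θ)) (fun t => ?_) _ using 1
    · simp [testPoint]
    · have hT : Sk κ₂ θ / Tk κ₂ θ = Ck κ₂ θ := by rw [Tk]; field_simp
      simp [J01, J03, J12, J23, testPoint]
      linear_combination (√2 / 2 / Tk κ₁ r * t) * hT

lemma grad_LRL₃_testPoint (k : ℝ) (hx : testPoint r θ p ∈ D κ₁ κ₂) :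
    grad (fun y => J01 κ₁ κ₂ y * J13 κ₂ y + J02 κ₁ κ₂ y * J23 y
        + k * κ₂ * Sk κ₂ (y 1) * Real.sin (y 2)) (testPoint r θ p) 2 =
      √2 / 2 * (-(Ck κ₂ θ * p / Tk κ₂ θ) - κ₂ * Sk κ₂ θ * p -
        (1 / (Tk κ₁ r * Sk κ₂ θ) - k * κ₂ * Sk κ₂ θ)) ∧
      grad (fun y => J01 κ₁ κ₂ y * J13 κ₂ y + J02 κ₁ κ₂ y * J23 y
        + k * κ₂ * Sk κ₂ (y 1) * Real.sin (y 2)) (testPoint r θ p) 4 =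
      √2 / 2 * (Ck κ₂ θ * p) := by
  have hS : Sk κ₂ θ ≠ 0 := hx.2.2.1
  have hC : Ck κ₂ θ ≠ 0 := hx.2.2.2.1
  constructor <;> refine grad_apply_eq (differentiableAt_LRL₃ k hx) ?_
  · convert hasDerivAt_cos_sin (a := Ck κ₂ θ * p / Tk κ₂ θ + κ₂ * Sk κ₂ θ * p)
      (b := -(1 / (Tk κ₁ r * Sk κ₂ θ)) + k * κ₂ * Sk κ₂ θ) (c := 0) (fun t => ?_) _ using 1
    · simp [testPoint]
      ring
    · simp [J01, J02, J13, J23, testPoint]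
      ring
  · convert hasDerivAt_quadratic (a := -(√2 / 2 * (Sk κ₂ θ / Tk κ₁ r)))
      (b := √2 / 2 * (Ck κ₂ θ * p))
      (c := √2 / 2 * (Ck κ₂ θ * p / Tk κ₂ θ + κ₂ * Sk κ₂ θ * p -
        1 / (Tk κ₁ r * Sk κ₂ θ) + k * κ₂ * Sk κ₂ θ)) (fun t => ?_) _ using 1
    · simp [testPoint]
    · have hT : Sk κ₂ θ / Tk κ₂ θ = Ck κ₂ θ := by rw [Tk]; field_simp
      simp [J01, J02, J13, J23, testPoint]
      linear_combination (-(√2 / 2 / Tk κ₁ r * t)) * hT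

end Gradients

/-- for each i ∈ {1,2,3}, the five functions I₁₂, I₂₃, I₁₂₃
(with β₁ = β₂ = β₃ = 0), H^KC and the Laplace–Runge–Lenz component Lᵢ are
functionally independent on D; hence H^KC is maximally superintegrable. -/
theorem KC_maximal_superintegrability (κ₁ κ₂ k : ℝ) (hκ₂ : κ₂ ≠ 0) :
    (∃ x ∈ D κ₁ κ₂, LinearIndependent ℝ
      ![grad (I12 κ₂ 0 0) x, grad (I23 κ₂ 0 0) x, grad (I123 κ₂ 0 0 0) x,
        grad (fun y => Tkin κ₁ κ₂ y - k / Tk κ₁ (y 0)) x,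
        grad (fun y => -(J02 κ₁ κ₂ y * J12 κ₂ y) - J03 κ₁ κ₂ y * J13 κ₂ y
          + k * κ₂ * Ck κ₂ (y 1)) x]) ∧
    (∃ x ∈ D κ₁ κ₂, LinearIndependent ℝ
      ![grad (I12 κ₂ 0 0) x, grad (I23 κ₂ 0 0) x, grad (I123 κ₂ 0 0 0) x,
        grad (fun y => Tkin κ₁ κ₂ y - k / Tk κ₁ (y 0)) x,
        grad (fun y => J01 κ₁ κ₂ y * J12 κ₂ y - J03 κ₁ κ₂ y * J23 y
          + k * κ₂ * Sk κ₂ (y 1) * Real.cos (y 2)) x]) ∧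
    (∃ x ∈ D κ₁ κ₂, LinearIndependent ℝ
      ![grad (I12 κ₂ 0 0) x, grad (I23 κ₂ 0 0) x, grad (I123 κ₂ 0 0 0) x,
        grad (fun y => Tkin κ₁ κ₂ y - k / Tk κ₁ (y 0)) x,
        grad (fun y => J01 κ₁ κ₂ y * J13 κ₂ y + J02 κ₁ κ₂ y * J23 y
          + k * κ₂ * Sk κ₂ (y 1) * Real.sin (y 2)) x]) := by
  obtain ⟨r, hr⟩ := exists_Sk_ne_zero_and_Ck_ne_zero κ₁
  obtain ⟨θ, hθ⟩ := exists_Sk_ne_zero_and_Ck_ne_zero κ₂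
  have hT : Tk κ₂ θ ≠ 0 := Tk_ne_zero hθ.1 hθ.2
  have hκS : κ₂ * Sk κ₂ θ ≠ 0 := mul_ne_zero hκ₂ hθ.1
  obtain ⟨Q, hQ⟩ : ∃ Q, Q = 1 / (Tk κ₁ r * Sk κ₂ θ) - k * κ₂ * Sk κ₂ θ := ⟨_, rfl⟩
  obtain ⟨p, hp⟩ : ∃ p, κ₂ * Sk κ₂ θ * p = Q ^ 2 + 1 := ⟨_, mul_div_cancel₀ _ hκS⟩
  have hp0 : p ≠ 0 := by
    rintro rfl
    nlinarith [sq_nonneg Q]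
  have hx : testPoint r θ p ∈ D κ₁ κ₂ := testPoint_mem_D hr hθ
  obtain ⟨hφ, hpθ⟩ := grad_I12_testPoint hx
  obtain ⟨hH2, hH3, hH4⟩ := grad_HKC_testPoint k hκ₂ hx
  have hH := And.intro hH2 (And.intro (hH3.trans_ne hp0) hH4)
  have hs : √(2 : ℝ) / 2 ≠ 0 := by positivity
  refine ⟨⟨_, hx, ?_⟩, ⟨_, hx, ?_⟩, ⟨_, hx, ?_⟩⟩ <;>
    refine linearIndependent_of_minors grad_I23_testPoint (grad_I123_testPoint hx) hH ?_ <;>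
    rw [hφ, hpθ]
  · obtain ⟨h2, h4⟩ := grad_LRL₁_testPoint k hx
    rw [h2, h4, mul_zero, sub_zero]
    exact mul_ne_zero (by positivity) (neg_ne_zero.2 (mul_ne_zero hκS hp0))
  · obtain ⟨h2, h4⟩ := grad_LRL₂_testPoint k hx
    rw [h2, h4, ← hQ, hp]
    have : Q - (Q ^ 2 + 1) ≠ 0 := by nlinarith [sq_nonneg (Q - 1), sq_nonneg Q]
    convert mul_ne_zero (div_ne_zero hs hT) this using 1
    ring
  · obtain ⟨h2, h4⟩ := grad_LRL₃_testPoint k hx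
    rw [h2, h4, ← hQ, hp]
    have : -Q - (Q ^ 2 + 1) ≠ 0 := by nlinarith [sq_nonneg (Q + 1), sq_nonneg Q]
    convert mul_ne_zero (div_ne_zero hs hT) this using 1
    ring

end
end Paper
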